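/- Let k ≥ 3, χ ≥ 2, t ≥ k-1, and n ≥ 3(k-1) be integers with n ≡ 1 (mod k-1). Let H be a k-graph whose vertex set is partitioned as A_1 ⊔ … ⊔ A_χ, where |A_i| > (χ-1)(k-2) + τ(k-1,t) for all i ∈ [χ-1] and |A_χ| = t, and whose edges are exactly those k-subsets e of the vertex set satisfying |e ∩ A_i| = k-1 for some i ∈ [χ]. Then R(P_{n,1}^{(k)}, H) ≥ (χ-1)(n-1) + τ(k-1,t) - 2k + 3. -/

import Mathlib

open scoped Classical

/-- There is a copy of the hypergraph with edge set `F` all of whose edges receive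
colour `b` under the red/blue colouring `c` (`true` = red, `false` = blue) of the
complete hypergraph on the vertex type `V`. -/
def hasMonoCopy {V W : Type*} [DecidableEq V] [DecidableEq W]
    (c : Finset V → Bool) (b : Bool) (F : Finset (Finset W)) : Prop :=
  ∃ f : W → V, Function.Injective f ∧ ∀ e ∈ F, c (e.image f) = b

/-- The Ramsey number of a pair of hypergraphs: the least `N` such that every
red/blue colouring of the complete hypergraph on `N` vertices contains a red copy
of `G` or a blue copy of `H`. -/
noncomputable def ramseyNumber {V W : Type*} [DecidableEq V] [DecidableEq W]
    (G : Finset (Finset V)) (H : Finset (Finset W)) : ℕ :=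
  sInf {N : ℕ | ∀ c : Finset (Fin N) → Bool,
    hasMonoCopy c true G ∨ hasMonoCopy c false H}

/-- `E` is a `k`-uniform hypergraph: every edge has exactly `k` vertices. -/
def IsUniformHyp {V : Type*} (k : ℕ) (E : Finset (Finset V)) : Prop :=
  ∀ e ∈ E, e.card = k
/-- The edge set of the `k`-uniform `ℓ`-path on `n` vertices `0, …, n-1`
(for `n ≡ ℓ (mod k-ℓ)`): the `i`-th edge consists of the vertices
`i(k-ℓ), …, i(k-ℓ)+k-1`. -/
def ellPathEdges (k ℓ n : ℕ) : Finset (Finset (Fin n)) :=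
  (Finset.range ((n - ℓ) / (k - ℓ))).image (fun i =>
    Finset.univ.filter (fun v : Fin n => i * (k - ℓ) ≤ (v : ℕ) ∧ (v : ℕ) < i * (k - ℓ) + k))
/-- The independence number of a hypergraph: the largest size of a vertex set
containing no edge. -/
noncomputable def indepNum {V : Type*} [Fintype V] (E : Finset (Finset V)) : ℕ :=
  Finset.sup (Finset.univ.filter (fun S : Finset V => ∀ e ∈ E, ¬ e ⊆ S)) Finset.card

/-- `E` contains no loose path of length two, i.e. no two (distinct) edges sharing
exactly one vertex. -/
def NoLoosePathTwo {V : Type*} [DecidableEq V] (E : Finset (Finset V)) : Prop :=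
  ∀ e ∈ E, ∀ f ∈ E, e ≠ f → (e ∩ f).card ≠ 1

/-- `τ(k, α)`: the largest `n` such that there is a `k`-uniform hypergraph on `n`
vertices with independence number less than `α` and no loose path of length two. -/
noncomputable def tauFn (k α : ℕ) : ℕ :=
  sSup {n : ℕ | ∃ E : Finset (Finset (Fin n)),
    IsUniformHyp k E ∧ indepNum E < α ∧ NoLoosePathTwo E}

theorem ramsey_aux : ∀ r p q : ℕ, ∃ N : ℕ, ∀ (V : Type) [DecidableEq V] (S : Finset V), N ≤ S.card →
    ∀ c : Finset V → Bool,
      (∃ T ⊆ S, T.card = p ∧ ∀ e ⊆ T, e.card = r → c e = true) ∨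
      (∃ T ⊆ S, T.card = q ∧ ∀ e ⊆ T, e.card = r → c e = false) := by
  intro r
  induction r with
  | zero =>
    intro p q
    refine ⟨max p q, fun V _ S hS c => ?_⟩
    cases h : c ∅ with
    | true =>
      left
      obtain ⟨T, hT, hc⟩ := Finset.exists_subset_card_eq (le_trans (le_max_left p q) hS)
      refine ⟨T, hT, hc, fun e _ he => ?_⟩
      rw [Finset.card_eq_zero.mp he, h]
    | false =>
      right
      obtain ⟨T, hT, hc⟩ := Finset.exists_subset_card_eq (le_trans (le_max_right p q) hS)
      refine ⟨T, hT, hc, fun e _ he => ?_⟩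
      rw [Finset.card_eq_zero.mp he, h]
  | succ r ihr =>
    intro p
    induction p with
    | zero =>
      intro q
      refine ⟨0, fun V _ S hS c => Or.inl ⟨∅, by simp, by simp, fun e he hc => ?_⟩⟩
      rw [Finset.subset_empty.mp he] at hc
      simp at hc
    | succ p ihp =>
      intro q
      induction q with
      | zero =>
        refine ⟨0, fun V _ S hS c => Or.inr ⟨∅, by simp, by simp, fun e he hc => ?_⟩⟩
        rw [Finset.subset_empty.mp he] at hc
        simp at hc
      | succ q ihq =>
        obtain ⟨N1, h1⟩ := ihp (q + 1)
        obtain ⟨N2, h2⟩ := ihq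
        obtain ⟨N, hN⟩ := ihr N1 N2
        refine ⟨N + 1, fun V _ S hS c => ?_⟩
        have hne : S.Nonempty := by
          rw [← Finset.card_pos]; omega
        obtain ⟨v, hv⟩ := hne
        have hins : ∀ (b : Bool) (T T' : Finset V), T ⊆ S.erase v → T' ⊆ T →
            (∀ e ⊆ T, e.card = r → c (insert v e) = b) →
            (∀ e ⊆ T', e.card = r + 1 → c e = b) →
            ∀ e ⊆ insert v T', e.card = r + 1 → c e = b := by
          intro b T T' hT hT' ha hb e he hc
          by_cases hve : v ∈ e
          · have := ha (e.erase v) (fun x hx => by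
              have h1 := Finset.mem_erase.mp hx
              have h2 := Finset.mem_insert.mp (he h1.2)
              exact hT' (h2.resolve_left h1.1)) (by rw [Finset.card_erase_of_mem hve]; omega)
            rwa [Finset.insert_erase hve] at this
          · refine hb e (fun x hx => ?_) hc
            have h2 := Finset.mem_insert.mp (he hx)
            rcases h2 with h2 | h2
            · exact absurd (h2 ▸ hx) hve
            · exact h2
        have hsub : ∀ T ⊆ S.erase v, insert v T ⊆ S ∧ (insert v T).card = T.card + 1 := by
          intro T hT
          refine ⟨Finset.insert_subset hv (hT.trans (Finset.erase_subset _ _)), ?_⟩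
          exact Finset.card_insert_of_notMem (fun h => Finset.notMem_erase v S (hT h))
        rcases hN V (S.erase v) (by rw [Finset.card_erase_of_mem hv]; omega)
          (fun e => c (insert v e)) with ⟨T, hT, hTc, hTe⟩ | ⟨T, hT, hTc, hTe⟩
        · rcases h1 V T hTc.ge c with ⟨T', hT', hc', he'⟩ | ⟨T', hT', hc', he'⟩
          · left
            refine ⟨insert v T', (hsub T' (hT'.trans hT)).1, ?_, hins true T T' hT hT' hTe he'⟩
            rw [(hsub T' (hT'.trans hT)).2, hc']
          · right
            exact ⟨T', hT'.trans (hT.trans (Finset.erase_subset _ _)), hc', he'⟩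
        · rcases h2 V T hTc.ge c with ⟨T', hT', hc', he'⟩ | ⟨T', hT', hc', he'⟩
          · left
            exact ⟨T', hT'.trans (hT.trans (Finset.erase_subset _ _)), hc', he'⟩
          · right
            refine ⟨insert v T', (hsub T' (hT'.trans hT)).1, ?_, hins false T T' hT hT' hTe he'⟩
            rw [(hsub T' (hT'.trans hT)).2, hc']

theorem mono_of_clique {N a k : ℕ} (c : Finset (Fin N) → Bool) (b : Bool)
    (F : Finset (Finset (Fin a))) (hF : ∀ e ∈ F, e.card = k) (T : Finset (Fin N))
    (hT : T.card = a) (h : ∀ e ⊆ T, e.card = k → c e = b) : hasMonoCopy c b F := by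
  let g := T.orderEmbOfFin hT
  refine ⟨g, g.injective, fun e he => h _ ?_ ?_⟩
  · intro x hx
    obtain ⟨y, _, rfl⟩ := Finset.mem_image.mp hx
    exact Finset.orderEmbOfFin_mem T hT y
  · rw [Finset.card_image_of_injective _ g.injective, hF e he]

theorem ramsey_nonempty {a b k : ℕ} (G : Finset (Finset (Fin a))) (H : Finset (Finset (Fin b)))
    (hG : ∀ e ∈ G, e.card = k) (hH : ∀ e ∈ H, e.card = k) :
    {N : ℕ | ∀ c : Finset (Fin N) → Bool,
      hasMonoCopy c true G ∨ hasMonoCopy c false H}.Nonempty := by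
  obtain ⟨N, hN⟩ := ramsey_aux k a b
  refine ⟨N, fun c => ?_⟩
  rcases hN (Fin N) Finset.univ (by simp) c with ⟨T, _, h1, h2⟩ | ⟨T, _, h1, h2⟩
  · exact Or.inl (mono_of_clique c true G hG T h1 h2)
  · exact Or.inr (mono_of_clique c false H hH T h1 h2)

theorem ramsey_lower {a b k : ℕ} (G : Finset (Finset (Fin a))) (H : Finset (Finset (Fin b)))
    (hG : ∀ e ∈ G, e.card = k) (hH : ∀ e ∈ H, e.card = k)
    {V : Type} [Fintype V] [DecidableEq V] (c : Finset V → Bool)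
    (h1 : ¬ hasMonoCopy c true G) (h2 : ¬ hasMonoCopy c false H) :
    Fintype.card V + 1 ≤ ramseyNumber G H := by
  have hmem := Nat.sInf_mem (ramsey_nonempty G H hG hH)
  change Fintype.card V + 1 ≤ sInf _
  by_contra hlt
  set N := sInf {N : ℕ | ∀ c : Finset (Fin N) → Bool,
      hasMonoCopy c true G ∨ hasMonoCopy c false H} with hNdef
  have hle : N ≤ Fintype.card V := by omega
  let g : Fin N → V := fun x => (Fintype.equivFin V).symm (Fin.castLE hle x)
  have hg : Function.Injective g := by
    intro x y h
    have := (Fintype.equivFin V).symm.injective h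
    exact Fin.castLE_injective hle this
  have key : ∀ (d : ℕ) (b : Bool) (F : Finset (Finset (Fin d))),
      hasMonoCopy (fun e => c (e.image g)) b F → hasMonoCopy c b F := by
    rintro d b F ⟨f, hf, he⟩
    refine ⟨g ∘ f, hg.comp hf, fun e hh => ?_⟩
    have := he e hh
    simpa [Finset.image_image] using this
  rcases hmem (fun e => c (e.image g)) with h | h
  · exact h1 (key _ _ _ h)
  · exact h2 (key _ _ _ h)

def RedE {V : Type} [DecidableEq V] (m : ℕ) (cls : V → ℕ) (F : Finset (Finset V))
    (e : Finset V) : Prop :=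
  (∃ j ≤ m, ∀ v ∈ e, cls v = j) ∨ (∃ f ∈ F, ∃ v, cls v = m ∧ e = insert v f)

theorem shared_cls {V : Type} [DecidableEq V] {m d : ℕ} {cls : V → ℕ} {F : Finset (Finset V)}
    (hd : 2 ≤ d)
    (hFu : ∀ f ∈ F, f.card = d) (hFn : NoLoosePathTwo F)
    {e e' : Finset V} (he : RedE m cls F e) (he' : RedE m cls F e') {x : V}
    (hx : e ∩ e' = {x}) : cls x ≠ m + 1 := by
  intro hxm
  have hxe : x ∈ e ∧ x ∈ e' := by
    rw [← Finset.mem_inter, hx]; simp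
  have ext : ∀ e : Finset V, RedE m cls F e → x ∈ e → ∃ f ∈ F, x ∈ f ∧ f ⊆ e := by
    rintro e (⟨j, hj, h⟩ | ⟨f, hf, v, hv, rfl⟩) hxe
    · have := h x hxe; omega
    · refine ⟨f, hf, ?_, Finset.subset_insert _ _⟩
      rcases Finset.mem_insert.mp hxe with h | h
      · subst h; omega
      · exact h
  obtain ⟨f, hf, hxf, hfe⟩ := ext e he hxe.1
  obtain ⟨f', hf', hxf', hfe'⟩ := ext e' he' hxe.2
  have hi : f ∩ f' = {x} := by
    apply Finset.Subset.antisymm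
    · rw [← hx]; exact Finset.inter_subset_inter hfe hfe'
    · simp [hxf, hxf']
  by_cases hff : f = f'
  · subst hff
    have := hFu f hf
    rw [Finset.inter_self] at hi
    rw [hi] at this
    simp at this; omega
  · exact hFn f hf f' hf' hff (by rw [hi]; simp)

theorem no_red {V : Type} [Fintype V] [DecidableEq V] {m d q : ℕ} {cls : V → ℕ}
    {F : Finset (Finset V)} (hd : 2 ≤ d) (hq : 3 ≤ q)
    (hFu : ∀ f ∈ F, f.card = d) (hFn : NoLoosePathTwo F)
    (hFc : ∀ f ∈ F, ∀ v ∈ f, cls v = m + 1)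
    (hm : (Finset.univ.filter (fun v => cls v = m)).card + 2 * d < q * d + 1)
    (hj : ∀ j < m, (Finset.univ.filter (fun v => cls v = j)).card < q * d + 1)
    (g : ℕ → V) (hg : ∀ x y, x ≤ q * d → y ≤ q * d → g x = g y → x = y)
    (hred : ∀ i < q, RedE m cls F ((Finset.Icc (i * d) ((i + 1) * d)).image g)) : False := by
  have hle : ∀ i ≤ q, i * d ≤ q * d := fun i hi => Nat.mul_le_mul_right d hi
  have hsh : ∀ i, i + 1 < q → cls (g ((i + 1) * d)) ≠ m + 1 := by
    intro i hi
    refine shared_cls hd hFu hFn (hred i (by omega)) (hred (i + 1) hi) ?_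
    ext x
    simp only [Finset.mem_inter, Finset.mem_image, Finset.mem_Icc, Finset.mem_singleton]
    constructor
    · rintro ⟨⟨a, ha, rfl⟩, ⟨b, hb, hab⟩⟩
      have h1 := hle (i + 1) (by omega)
      have h2 := hle (i + 1 + 1) (by omega)
      have := hg b a (by omega) (by omega) hab
      subst this
      congr 1; omega
    · rintro rfl
      refine ⟨⟨_, ⟨?_, le_rfl⟩, rfl⟩, ⟨_, ⟨le_rfl, ?_⟩, rfl⟩⟩ <;> (apply Nat.mul_le_mul_right; omega)
  have hmemL : ∀ i, g (i * d) ∈ (Finset.Icc (i * d) ((i + 1) * d)).image g := fun i =>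
    Finset.mem_image_of_mem _ (by rw [Finset.mem_Icc]; exact ⟨le_rfl, Nat.mul_le_mul_right d (by omega)⟩)
  have hmemR : ∀ i, g ((i + 1) * d) ∈ (Finset.Icc (i * d) ((i + 1) * d)).image g := fun i =>
    Finset.mem_image_of_mem _ (by rw [Finset.mem_Icc]; exact ⟨Nat.mul_le_mul_right d (by omega), le_rfl⟩)
  -- interior edges lie in one class
  have hint : ∀ i, i + 2 < q → ∃ j ≤ m, ∀ v ∈ (Finset.Icc ((i + 1) * d) ((i + 1 + 1) * d)).image g,
      cls v = j := by
    intro i hi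
    rcases hred (i + 1) (by omega) with h | ⟨f, hf, v, hv, he⟩
    · exact h
    · exfalso
      have h1 := hmemL (i + 1)
      have h2 := hmemR (i + 1)
      rw [he] at h1 h2
      have e1 : g ((i + 1) * d) = v := by
        rcases Finset.mem_insert.mp h1 with h | h
        · exact h
        · exact absurd (hFc f hf _ h) (hsh i (by omega))
      have e2 : g ((i + 1 + 1) * d) = v := by
        rcases Finset.mem_insert.mp h2 with h | h
        · exact h
        · exact absurd (hFc f hf _ h) (hsh (i + 1) (by omega))
      have := hg _ _ (hle _ (by omega)) (hle _ (by omega)) (e1.trans e2.symm)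
      have h3 : (i + 1 + 1) * d = (i + 1) * d + d := by ring
      omega
  obtain ⟨j, hjm, hj0⟩ := hint 0 (by omega)
  have hcl : ∀ i, i + 1 < q → cls (g ((i + 1) * d)) = j := by
    intro i
    induction i with
    | zero => intro _; exact hj0 _ (hmemL (0 + 1))
    | succ i ih =>
      intro hi
      obtain ⟨j', _, h'⟩ := hint i (by omega)
      rw [h' _ (hmemR (i + 1)), ← h' _ (hmemL (i + 1))]
      exact ih (by omega)
  have hall : ∀ i, i + 2 < q → ∀ x, (i + 1) * d ≤ x → x ≤ (i + 1 + 1) * d → cls (g x) = j := by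
    intro i hi x h1 h2
    obtain ⟨j', _, h'⟩ := hint i hi
    rw [h' (g x) (Finset.mem_image_of_mem _ (Finset.mem_Icc.mpr ⟨h1, h2⟩)), ← h' _ (hmemL (i + 1))]
    exact hcl i (by omega)
  obtain ⟨p, rfl⟩ : ∃ p, q = p + 3 := ⟨q - 3, by omega⟩
  have hmid : ∀ x, d ≤ x → x ≤ (p + 2) * d → cls (g x) = j := by
    intro x h1 h2
    rcases Nat.lt_or_ge x ((p + 2) * d) with h | h
    · have hdx := Nat.div_add_mod x d
      have hml := Nat.mod_lt x (show 0 < d by omega)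
      have hlt : x / d < p + 2 := (Nat.div_lt_iff_lt_mul (by omega)).mpr h
      have hge : 1 ≤ x / d := (Nat.one_le_div_iff (by omega)).mpr h1
      obtain ⟨i, hi⟩ : ∃ i, x / d = i + 1 := ⟨x / d - 1, by omega⟩
      refine hall i (by omega) x ?_ ?_
      · rw [hi] at hdx; rw [Nat.mul_comm]; omega
      · rw [hi] at hdx
        have : (i + 1 + 1) * d = d * (i + 1) + d := by ring
        omega
    · have : x = (p + 1 + 1) * d := by
        have : (p + 1 + 1) * d = (p + 2) * d := by ring
        omega
      rw [this]; exact hcl (p + 1) (by omega)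
  have hcount : ∀ a b, b ≤ (p + 3) * d → (∀ x, a ≤ x → x ≤ b → cls (g x) = j) →
      b + 1 - a ≤ (Finset.univ.filter (fun v => cls v = j)).card := by
    intro a b hb h
    rw [← Nat.card_Icc, ← Finset.card_image_of_injOn (s := Finset.Icc a b) (f := g)]
    · apply Finset.card_le_card
      intro v hv
      obtain ⟨x, hx, rfl⟩ := Finset.mem_image.mp hv
      rw [Finset.mem_Icc] at hx
      simp [h x hx.1 hx.2]
    · intro x hx y hy hxy
      simp only [Finset.coe_Icc, Set.mem_Icc] at hx hy
      exact hg x y (by omega) (by omega) hxy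
  have e3 : (p + 3) * d = (p + 2) * d + d := by ring
  have e4 : (p + 2) * d = p * d + 2 * d := by ring
  rcases Nat.lt_or_ge j m with hlt | hge
  · have hend : ∀ i < p + 3, ∀ y ∈ (Finset.Icc (i * d) ((i + 1) * d)).image g, cls y = j →
        ∀ v ∈ (Finset.Icc (i * d) ((i + 1) * d)).image g, cls v = j := by
      intro i hi y hy hyj
      rcases hred i hi with ⟨j', _, h⟩ | ⟨f, hf, v, hv, he⟩
      · have := h y hy
        intro v hv; rw [h v hv]; omega
      · exfalso
        rw [he] at hy
        rcases Finset.mem_insert.mp hy with h | h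
        · subst h; omega
        · have := hFc f hf y h; omega
    have := hcount 0 ((p + 3) * d) le_rfl (by
      intro x _ hx
      rcases Nat.lt_or_ge x d with h | h
      · refine hend 0 (by omega) _ (hmemR 0) (hcl 0 (by omega)) _ (Finset.mem_image_of_mem _ ?_)
        rw [Finset.mem_Icc]; constructor <;> simp; omega
      · rcases Nat.lt_or_ge ((p + 2) * d) x with h' | h'
        · refine hend (p + 2) (by omega) _ (hmemL (p + 2)) (hcl (p + 1) (by omega)) _
            (Finset.mem_image_of_mem _ ?_)
          rw [Finset.mem_Icc]
          exact ⟨by omega, hx⟩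
        · exact hmid x h h')
    have := hj j hlt
    omega
  · have hjm' : j = m := by omega
    have := hcount d ((p + 2) * d) (by omega) hmid
    rw [hjm'] at this
    omega

theorem no_blue {V : Type} [Fintype V] [DecidableEq V] {m k t τ nH : ℕ} {cls : V → ℕ}
    (hk : 3 ≤ k) {F : Finset (Finset V)} (hcls : ∀ v, cls v ≤ m + 1)
    (hFu : ∀ f ∈ F, f.card = k - 1)
    (hFt : ∀ S : Finset V, (∀ v ∈ S, cls v = m + 1) → S.card = t → ∃ f ∈ F, f ⊆ S)
    (hτ : (Finset.univ.filter (fun v => cls v = m + 1)).card ≤ τ)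
    (H : Finset (Finset (Fin nH))) (part : Fin nH → Fin (m + 2))
    (hA : ∀ i : Fin (m + 2), (i : ℕ) + 1 < m + 2 →
      (m + 1) * (k - 2) + τ < (Finset.univ.filter (fun v => part v = i)).card)
    (hlast : ∀ i : Fin (m + 2), (i : ℕ) + 1 = m + 2 →
      (Finset.univ.filter (fun v => part v = i)).card = t)
    (hedges : ∀ e : Finset (Fin nH), 
      (e.card = k ∧ ∃ i : Fin (m + 2), (e.filter (fun v => part v = i)).card = k - 1) → e ∈ H)
    (f : Fin nH → V) (hf : Function.Injective f)
    (hblue : ∀ e ∈ H, ¬ RedE m cls F (e.image f)) : False := by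
  have hJ : ∀ i : Fin (m + 1), ∃ j : Fin (m + 1), k - 1 ≤
      ((Finset.univ.filter (fun v => part v = i.castSucc)).filter (fun v => cls (f v) = j)).card := by
    intro i
    by_contra! hcon
    have h1 := hA i.castSucc (by simp only [Fin.val_castSucc]; omega)
    rw [Finset.card_eq_sum_card_fiberwise (f := fun v => cls (f v)) (t := Finset.range (m + 2))
      (by intro v _; simp only [Finset.coe_range, Set.mem_Iio]; have := hcls (f v); omega),
      Finset.sum_range_succ] at h1
    have h2 : ∑ j ∈ Finset.range (m + 1), ((Finset.univ.filter (fun v => part v = i.castSucc)).filter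
        (fun v => cls (f v) = j)).card ≤ (m + 1) * (k - 2) := by
      have := Finset.sum_le_card_nsmul (Finset.range (m + 1)) (fun j =>
        ((Finset.univ.filter (fun v => part v = i.castSucc)).filter
        (fun v => cls (f v) = j)).card) (k - 2) (by
          intro j hj
          have := hcon ⟨j, Finset.mem_range.mp hj⟩
          simp only at this ⊢
          omega)
      simpa using this
    have h3 : ((Finset.univ.filter (fun v => part v = i.castSucc)).filter
        (fun v => cls (f v) = m + 1)).card ≤ τ := by
      refine le_trans ?_ hτ
      rw [← Finset.card_image_of_injective _ hf]
      apply Finset.card_le_card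
      intro v hv
      obtain ⟨x, hx, rfl⟩ := Finset.mem_image.mp hv
      simp at hx ⊢
      exact hx.2
    omega
  choose J hJc using hJ
  have hedge : ∀ (i : Fin (m + 2)) (u : Finset (Fin nH)) (w : Fin nH), (∀ v ∈ u, part v = i) →
      u.card = k - 1 → part w ≠ i → insert w u ∈ H := by
    intro i u w hu hc hw
    have hwu : w ∉ u := fun h => hw (hu w h)
    refine hedges _ ⟨by rw [Finset.card_insert_of_notMem hwu]; omega, i, ?_⟩
    rw [Finset.filter_insert, if_neg hw, Finset.filter_true_of_mem hu, hc]
  have havoid : ∀ (i : Fin (m + 1)) (w : Fin nH), part w ≠ i.castSucc → cls (f w) ≠ J i := by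
    intro i w hw hcw
    obtain ⟨u, hu, hc⟩ := Finset.exists_subset_card_eq (hJc i)
    have hu' : ∀ v ∈ u, part v = i.castSucc ∧ cls (f v) = J i := by
      intro v hv; simpa using hu hv
    refine hblue _ (hedge i.castSucc u w (fun v hv => (hu' v hv).1) hc hw) (Or.inl ⟨J i, by omega, ?_⟩)
    intro v hv
    obtain ⟨x, hx, rfl⟩ := Finset.mem_image.mp hv
    rcases Finset.mem_insert.mp hx with rfl | hx
    · exact hcw
    · exact (hu' x hx).2
  have hex : ∀ i : Fin (m + 1), ∃ w, part w = i.castSucc ∧ cls (f w) = J i := by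
    intro i
    have h := hJc i
    obtain ⟨w, hw⟩ := Finset.card_pos.mp (show 0 < _ from lt_of_lt_of_le (by omega) h)
    exact ⟨w, by simpa using hw⟩
  have hinj : Function.Injective J := by
    intro i i' hii
    by_contra hne
    obtain ⟨w, hw, hw'⟩ := hex i'
    refine havoid i w ?_ (by rw [hw', hii])
    rw [hw]
    intro h
    exact hne (Fin.castSucc_injective _ h).symm
  have hsurj : Function.Surjective J := Finite.injective_iff_surjective.mp hinj
  have hlastc : ∀ w, part w = Fin.last (m + 1) → cls (f w) = m + 1 := by
    intro w hw
    by_contra hne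
    have h1 := hcls (f w)
    obtain ⟨i, hi⟩ := hsurj ⟨cls (f w), by omega⟩
    refine havoid i w ?_ (by rw [hi])
    rw [hw]
    exact (Fin.castSucc_ne_last i).symm
  obtain ⟨f0, hf0, hsub⟩ := hFt ((Finset.univ.filter (fun v => part v = Fin.last (m + 1))).image f) (by
      intro v hv
      obtain ⟨x, hx, rfl⟩ := Finset.mem_image.mp hv
      exact hlastc x (by simpa using hx)) (by
      rw [Finset.card_image_of_injective _ hf]
      exact hlast (Fin.last (m + 1)) (by simp))
  obtain ⟨u, hu, rfl⟩ := Finset.subset_image_iff.mp hsub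
  obtain ⟨i, hi⟩ := hsurj (Fin.last m)
  obtain ⟨w, hw, hwc⟩ := hex i
  have hu' : ∀ v ∈ u, part v = Fin.last (m + 1) := fun v hv => by simpa using hu hv
  refine hblue _ (hedge (Fin.last (m + 1)) u w hu' ?_ ?_) (Or.inr ⟨_, hf0, f w, ?_, ?_⟩)
  · rw [← Finset.card_image_of_injective _ hf]; exact hFu _ hf0
  · rw [hw]; exact Fin.castSucc_ne_last i
  · rw [hwc, hi]; simp
  · rw [Finset.image_insert]

theorem tau_mem {k t : ℕ} (ht : 0 < t) : ∃ E : Finset (Finset (Fin (tauFn k t))),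
    IsUniformHyp k E ∧ indepNum E < t ∧ NoLoosePathTwo E := by
  have h0 : (0 : ℕ) ∈ {n : ℕ | ∃ E : Finset (Finset (Fin n)),
    IsUniformHyp k E ∧ indepNum E < t ∧ NoLoosePathTwo E} := by
    refine ⟨∅, by simp [IsUniformHyp], ?_, by simp [NoLoosePathTwo]⟩
    unfold indepNum
    rw [Finset.sup_lt_iff (by simpa using ht)]
    intro S _
    have : S = ∅ := Finset.eq_empty_of_isEmpty S
    simpa [this] using ht
  by_cases hb : BddAbove {n : ℕ | ∃ E : Finset (Finset (Fin n)),
    IsUniformHyp k E ∧ indepNum E < t ∧ NoLoosePathTwo E}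
  · exact Nat.sSup_mem ⟨0, h0⟩ hb
  · have : tauFn k t = 0 := by
      unfold tauFn
      exact Nat.sSup_of_not_bddAbove hb
    rw [this]; exact h0

/-- Lower bound for loose paths: for the `k`-graph `H` whose vertex set is
partitioned (by `part`) into classes `A₀, …, A_{χ-1}` with `|A_i| > (χ-1)(k-2) + τ(k-1,t)`
for the first `χ-1` classes and `|A_{χ-1}| = t`, and whose edges are exactly the
`k`-sets meeting some class in exactly `k-1` vertices,
`R(P_{n,1}^{(k)}, H) ≥ (χ-1)(n-1) + τ(k-1,t) - 2k + 3`. -/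
theorem loosePath_lower {k χ t n nH : ℕ} (hk : 3 ≤ k) (hχ : 2 ≤ χ)
    (ht : k - 1 ≤ t) (hn : 3 * (k - 1) ≤ n) (hmod : n ≡ 1 [MOD k - 1])
    (H : Finset (Finset (Fin nH))) (part : Fin nH → Fin χ)
    (hA : ∀ i : Fin χ, (i : ℕ) + 1 < χ →
      (χ - 1) * (k - 2) + tauFn (k - 1) t <
        (Finset.univ.filter (fun v => part v = i)).card)
    (hlast : ∀ i : Fin χ, (i : ℕ) + 1 = χ →
      (Finset.univ.filter (fun v => part v = i)).card = t)
    (hedges : ∀ e : Finset (Fin nH), e ∈ H ↔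
      (e.card = k ∧ ∃ i : Fin χ, (e.filter (fun v => part v = i)).card = k - 1)) :
    (χ - 1) * (n - 1) + tauFn (k - 1) t + 3 - 2 * k ≤
      ramseyNumber (ellPathEdges k 1 n) H := by
  obtain ⟨m, rfl⟩ : ∃ m, χ = m + 2 := ⟨χ - 2, by omega⟩
  obtain ⟨d, rfl⟩ : ∃ d, k = d + 1 := ⟨k - 1, by omega⟩
  simp only [Nat.add_sub_cancel] at ht hn hmod
  obtain ⟨q, rfl⟩ : ∃ q, n = q * d + 1 := by
    have h1 : 1 ≤ n := by omega
    have h2 := (Nat.modEq_iff_dvd' h1).mp hmod.symm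
    obtain ⟨q, hq⟩ := h2
    exact ⟨q, by rw [Nat.mul_comm]; omega⟩
  have hq : 3 ≤ q := by
    by_contra hlt
    have : q * d ≤ 2 * d := Nat.mul_le_mul_right d (by omega)
    omega
  have hqd : 3 * d ≤ q * d := Nat.mul_le_mul_right d hq
  have hpath : ∀ i < q, Finset.univ.filter (fun v : Fin (q * d + 1) =>
      i * (d + 1 - 1) ≤ (v : ℕ) ∧ (v : ℕ) < i * (d + 1 - 1) + (d + 1)) ∈
      ellPathEdges (d + 1) 1 (q * d + 1) := by
    intro i hi
    unfold ellPathEdges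
    refine Finset.mem_image.mpr ⟨i, ?_, rfl⟩
    rw [Finset.mem_range]
    simp only [Nat.add_sub_cancel]
    rwa [Nat.mul_div_cancel _ (by omega)]
  have himg : ∀ i < q, ∀ (W : Type) [DecidableEq W] (f : Fin (q * d + 1) → W),
      (Finset.univ.filter (fun v : Fin (q * d + 1) =>
      i * (d + 1 - 1) ≤ (v : ℕ) ∧ (v : ℕ) < i * (d + 1 - 1) + (d + 1))).image f =
      (Finset.Icc (i * d) ((i + 1) * d)).image
        (fun x => if h : x < q * d + 1 then f ⟨x, h⟩ else f 0) := by
    intro i hi W _ f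
    have h1 : (i + 1) * d ≤ q * d := Nat.mul_le_mul_right d hi
    have h2 : (i + 1) * d = i * d + d := by ring
    ext w
    simp only [Finset.mem_image, Finset.mem_filter, Finset.mem_univ, true_and, Finset.mem_Icc,
      Nat.add_sub_cancel]
    constructor
    · rintro ⟨v, hv, rfl⟩
      exact ⟨v, by omega, by rw [dif_pos v.2]⟩
    · rintro ⟨x, hx, rfl⟩
      have hx' : x < q * d + 1 := by omega
      exact ⟨⟨x, hx'⟩, ⟨hx.1, by simp only; omega⟩, by simp [hx']⟩
  have hG : ∀ e ∈ ellPathEdges (d + 1) 1 (q * d + 1), e.card = d + 1 := by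
    intro e he
    unfold ellPathEdges at he
    obtain ⟨i, hi, rfl⟩ := Finset.mem_image.mp he
    rw [Finset.mem_range] at hi
    simp only [Nat.add_sub_cancel] at hi
    rw [Nat.mul_div_cancel _ (by omega)] at hi
    have h1 : (i + 1) * d ≤ q * d := Nat.mul_le_mul_right d hi
    have h2 : (i + 1) * d = i * d + d := by ring
    rw [← Finset.card_image_of_injective _ Fin.val_injective, himg i hi ℕ Fin.val,
      Finset.card_image_of_injOn, Nat.card_Icc]
    · omega
    · intro x hx y hy hxy
      simp only [Finset.coe_Icc, Set.mem_Icc] at hx hy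
      have hx' : x < q * d + 1 := by omega
      have hy' : y < q * d + 1 := by omega
      simpa [hx', hy'] using hxy
  have hH : ∀ e ∈ H, e.card = d + 1 := fun e he => ((hedges e).mp he).1
  have hE := tau_mem (k := d + 1 - 1) (t := t) (by omega)
  generalize tauFn (d + 1 - 1) t = τ at hE hA ⊢
  obtain ⟨E, hE1, hE2, hE3⟩ := hE
  let s := q * d - 2 * d
  let V := (Fin m × Fin (q * d)) ⊕ (Fin s ⊕ Fin τ)
  let cls : V → ℕ := Sum.elim (fun p => (p.1 : ℕ)) (Sum.elim (fun _ => m) (fun _ => m + 1))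
  let ι : Fin τ → V := fun x => Sum.inr (Sum.inr x)
  have hι : Function.Injective ι := fun x y h => by
    exact Sum.inr_injective (Sum.inr_injective h)
  let F : Finset (Finset V) := E.image (fun e => e.image ι)
  have hFu : ∀ f ∈ F, f.card = d := by
    intro f hf
    obtain ⟨e, he, rfl⟩ := Finset.mem_image.mp hf
    rw [Finset.card_image_of_injective _ hι]
    exact hE1 e he
  have hFn : NoLoosePathTwo F := by
    intro f hf f' hf' hne
    obtain ⟨e, he, rfl⟩ := Finset.mem_image.mp hf
    obtain ⟨e', he', rfl⟩ := Finset.mem_image.mp hf'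
    rw [← Finset.image_inter _ _ hι, Finset.card_image_of_injective _ hι]
    exact hE3 e he e' he' (fun h => hne (by rw [h]))
  have hFc : ∀ f ∈ F, ∀ v ∈ f, cls v = m + 1 := by
    intro f hf v hv
    obtain ⟨e, he, rfl⟩ := Finset.mem_image.mp hf
    obtain ⟨x, _, rfl⟩ := Finset.mem_image.mp hv
    rfl
  have hc2 : ∀ v, cls v = m + 1 → ∃ x, ι x = v := by
    rintro (⟨a, b⟩ | x | x) h
    · have := a.2; simp [cls] at h; omega
    · simp [cls] at h
    · exact ⟨x, rfl⟩
  have hFt : ∀ S : Finset V, (∀ v ∈ S, cls v = m + 1) → S.card = t → ∃ f ∈ F, f ⊆ S := by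
    intro S hS hSt
    have hsub : S ⊆ Finset.univ.image ι := by
      intro v hv
      obtain ⟨x, hx⟩ := hc2 v (hS v hv)
      exact Finset.mem_image.mpr ⟨x, by simp, hx⟩
    obtain ⟨U, _, rfl⟩ := Finset.subset_image_iff.mp hsub
    rw [Finset.card_image_of_injective _ hι] at hSt
    by_contra! hcon
    have : U.card ≤ indepNum E := by
      unfold indepNum
      apply Finset.le_sup (f := Finset.card)
      simp only [Finset.mem_filter, Finset.mem_univ, true_and]
      intro e he hle
      exact hcon _ (Finset.mem_image_of_mem _ he) (Finset.image_subset_image hle)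
    omega
  have hcard : ∀ (j a : ℕ) (φ : Fin a → V), (∀ v, cls v = j → ∃ x, φ x = v) →
      (Finset.univ.filter (fun v => cls v = j)).card ≤ a := by
    intro j a φ h
    calc _ ≤ (Finset.univ.image φ).card := by
          apply Finset.card_le_card
          intro v hv
          obtain ⟨x, hx⟩ := h v (by simpa using hv)
          exact Finset.mem_image.mpr ⟨x, by simp, hx⟩
      _ ≤ a := by
          refine Finset.card_image_le.trans ?_
          simp
  have hV : Fintype.card V = m * (q * d) + (s + τ) := by
    simp [V]
  have key := ramsey_lower (V := V) (ellPathEdges (d + 1) 1 (q * d + 1)) H hG hH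
    (fun e => decide (RedE m cls F e)) ?_ ?_
  · rw [hV] at key
    refine le_trans ?_ key
    have e1 : (m + 2 - 1) * (q * d + 1 - 1) = m * (q * d) + q * d := by
      simp only [Nat.add_sub_cancel]
      have : m + 2 - 1 = m + 1 := by omega
      rw [this]; ring
    rw [e1]
    omega
  · rintro ⟨f, hf, hred⟩
    refine no_red (m := m) (d := d) (q := q) (cls := cls) (F := F) (by omega) hq hFu hFn hFc ?_ ?_
      (fun x => if h : x < q * d + 1 then f ⟨x, h⟩ else f 0) ?_ ?_
    · have := hcard m s (fun x => Sum.inr (Sum.inl x)) (by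
        rintro (⟨a, b⟩ | x | x) h
        · have := a.2; simp [cls] at h; omega
        · exact ⟨x, rfl⟩
        · simp [cls] at h)
      omega
    · intro j hj
      have := hcard j (q * d) (fun x => Sum.inl (⟨j, hj⟩, x)) (by
        rintro (⟨a, b⟩ | x | x) h
        · refine ⟨b, ?_⟩
          simp [cls] at h
          subst h
          rfl
        · simp [cls] at h; omega
        · simp [cls] at h; omega)
      omega
    · intro x y hx hy hxy
      have hx' : x < q * d + 1 := by omega
      have hy' : y < q * d + 1 := by omega
      simp only [hx', hy', dif_pos] at hxy
      simpa using hf hxy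
    · intro i hi
      have := hred _ (hpath i hi)
      rw [himg i hi V f] at this
      simpa using this
  · rintro ⟨f, hf, hblue⟩
    refine no_blue (m := m) (k := d + 1) (t := t) (τ := τ) (cls := cls) (F := F) hk ?_ hFu hFt
      (hcard (m + 1) τ ι hc2) H part hA hlast (fun e he => (hedges e).mpr he) f hf ?_
    · rintro (⟨a, b⟩ | x | x)
      · have := a.2; simp [cls]; omega
      · simp [cls]
      · simp [cls]
    · intro e he
      simpa using hblue e he
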